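/- Let λ ∈ ℂ \ {0,1} and let K be the pair K¹ = u₃ + 3 D_x((u²+v²)u₁) − 2(λ−1)uv v₂ + (λ+2)u v₁² + 3(u⁴+v⁴)u₁ + 3u u₁² − 2(λ−1)(u²+3v²)uv v₁ − 2(2λ−5)u²v²u₁ − (λ−1)u v²(u²+v²)² and K² = λ v₃ + 2(λ−1)uv u₂ + 6λ u u₁v₁ + 9λ v v₁² + 3λ(u²+v²)v₂ + (2λ+1)v u₁² + 2(λ−1)uv(v²+3u²)u₁ + 3λ(u⁴+v⁴)v₁ + 2(5λ−2)u²v²v₁ + (λ−1)u²v(u²+v²)². Then (i) [(x u₁ + (1/2)u, x v₁ + (1/2)v), K] = 3K (the system is (1/2,1/2)-homogeneous of weight 3), and (ii) the pair τ = −(1/6)[(x²u₁ + xu, x²v₁ + xv), K] satisfies [τ,K] ≠ 0 and [[τ,K],K] = 0, i.e. τ is a master symmetry of the system u_t = K¹, v_t = K². -/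

import Mathlib

open MvPolynomial

/-- The two-component differential ring `𝒜₂ = ℂ[x, u₀, u₁, …, v₀, v₁, …]`:
variable `none` is `x`, `some (false, k)` is `u_k`, `some (true, k)` is `v_k`. -/
abbrev A2 : Type := MvPolynomial (Option (Bool × ℕ)) ℂ

/-- The variable `x`. -/
noncomputable def Xx : A2 := X none

/-- The variable `u_k`. -/
noncomputable def U (k : ℕ) : A2 := X (some (false, k))

/-- The variable `v_k`. -/
noncomputable def V (k : ℕ) : A2 := X (some (true, k))

/-- The total derivative `D_x = ∂/∂x + Σ_{k≥0} (u_{k+1} ∂/∂u_k + v_{k+1} ∂/∂v_k)`. -/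
noncomputable def Dx (P : A2) : A2 :=
  pderiv (none : Option (Bool × ℕ)) P +
    ∑ᶠ k : ℕ, (U (k + 1) * pderiv (some (false, k)) P +
      V (k + 1) * pderiv (some (true, k)) P)

/-- `frU P Q = P_{u*}(Q) = Σ_k (∂P/∂u_k) D_x^k(Q)`. -/
noncomputable def frU (P Q : A2) : A2 :=
  ∑ᶠ k : ℕ, pderiv (some (false, k)) P * Dx^[k] Q

/-- `frV P Q = P_{v*}(Q) = Σ_k (∂P/∂v_k) D_x^k(Q)`. -/
noncomputable def frV (P Q : A2) : A2 :=
  ∑ᶠ k : ℕ, pderiv (some (true, k)) P * Dx^[k] Q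

/-- The Lie bracket of two pairs (evolutionary vector fields). -/
noncomputable def lieBr2 (P J : A2 × A2) : A2 × A2 :=
  (frU J.1 P.1 + frV J.1 P.2 - frU P.1 J.1 - frV P.1 J.2,
   frU J.2 P.1 + frV J.2 P.2 - frU P.2 J.1 - frV P.2 J.2)

/-- The third-order Burgers flow `B₃[u] = u₃ + 3u u₂ + 3u² u₁ + 3u₁²`. -/
noncomputable def B3 : A2 := U 3 + 3 * U 0 * U 2 + 3 * U 0 ^ 2 * U 1 + 3 * U 1 ^ 2

theorem finite_support_pderiv_mul {s : ℕ → Option (Bool × ℕ)} (hs : s.Injective) (g : ℕ → A2)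
    (P : A2) : (Function.support fun k => pderiv (s k) P * g k).Finite := by
  refine (P.vars.finite_toSet.preimage hs.injOn).subset fun k hk => ?_
  by_contra h
  exact hk (by simp [pderiv_eq_zero_of_notMem_vars h])

theorem finsum_pderiv_mul {s : ℕ → Option (Bool × ℕ)} (hs : s.Injective) (g : ℕ → A2) (P : A2) :
    ∑ᶠ k, pderiv (s k) P * g k = mkDerivation ℂ (Function.extend s g 0) P := by
  induction P using MvPolynomial.induction_on with
  | C a => simp
  | add p q hp hq =>
    simp only [map_add, add_mul]
    rw [finsum_add_distrib (finite_support_pderiv_mul hs g p) (finite_support_pderiv_mul hs g q),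
      hp, hq]
  | mul_X p i hp =>
    have hX : ∑ᶠ k, pderiv (s k) (X i : A2) * g k = Function.extend s g 0 i := by
      by_cases h : ∃ k, s k = i
      · obtain ⟨k, rfl⟩ := h
        rw [hs.extend_apply, finsum_eq_single _ k, pderiv_X_self, one_mul]
        intro j hj
        rw [pderiv_X_of_ne fun h => hj (hs h).symm, zero_mul]
      · rw [Function.extend_apply' _ _ _ h]
        refine finsum_eq_zero_of_forall_eq_zero fun k => ?_
        rw [pderiv_X_of_ne fun hk => h ⟨k, hk.symm⟩, zero_mul]
    have hsplit : ∀ k, pderiv (s k) (p * X i) * g k =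
        p * (pderiv (s k) (X i : A2) * g k) + X i * (pderiv (s k) p * g k) := fun k => by
      rw [Derivation.leibniz, smul_eq_mul, smul_eq_mul]; ring
    have hfin := finite_support_pderiv_mul hs g
    rw [finsum_congr hsplit, finsum_add_distrib, ← mul_finsum, ← mul_finsum,
      hX, hp, Derivation.leibniz, mkDerivation_X, smul_eq_mul, smul_eq_mul]
    · exact (hfin (X i)).subset fun k hk h => hk (by simp only [h, mul_zero])
    · exact (hfin p).subset fun k hk h => hk (by simp only [h, mul_zero])

theorem injective_jet (b : Bool) : (fun k : ℕ => (some (b, k) : Option (Bool × ℕ))).Injective :=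
  fun i j h => by simpa using h

/-- The total derivative as a derivation. -/
noncomputable def totalDerivation : Derivation ℂ A2 A2 :=
  pderiv none +
    (mkDerivation ℂ (Function.extend (fun k => some (false, k)) (fun k => U (k + 1)) 0) +
    mkDerivation ℂ (Function.extend (fun k => some (true, k)) (fun k => V (k + 1)) 0))

theorem Dx_eq : Dx = totalDerivation := by
  funext P
  have hfin b := finite_support_pderiv_mul (injective_jet b)
  simp only [Dx, totalDerivation, Derivation.add_apply, ← finsum_pderiv_mul (injective_jet _),
      mul_comm (U _), mul_comm (V _)]
  rw [finsum_add_distrib (hfin false _ P) (hfin true _ P)]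

/-- The evolutionary derivation with characteristic `F`. -/
noncomputable def evolDerivation (F : A2 × A2) : Derivation ℂ A2 A2 :=
  mkDerivation ℂ (Function.extend (fun k => some (false, k)) (fun k => Dx^[k] F.1) 0) +
    mkDerivation ℂ (Function.extend (fun k => some (true, k)) (fun k => Dx^[k] F.2) 0)

theorem lieBr2_eq (P J : A2 × A2) :
    lieBr2 P J = (evolDerivation P J.1 - evolDerivation J P.1,
      evolDerivation P J.2 - evolDerivation J P.2) := by
  have h (F : A2 × A2) (Q : A2) : evolDerivation F Q = frU Q F.1 + frV Q F.2 := by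
    simp only [evolDerivation, frU, frV, Derivation.add_apply, ← finsum_pderiv_mul (injective_jet
        _)]
  simp only [lieBr2, h, sub_sub]

theorem extend_jet (b : Bool) (g : ℕ → A2) (i : Option (Bool × ℕ)) :
    Function.extend (fun k => some (b, k)) g 0 i =
      i.elim 0 fun j => if j.1 = b then g j.2 else 0 := by
  rcases i with _ | ⟨c, k⟩
  · exact Function.extend_apply' _ _ _ (by simp)
  · by_cases h : c = b
    · subst h
      simpa using (injective_jet c).extend_apply g 0 k
    · simp only [Option.elim_some, if_neg h]
      exact Function.extend_apply' _ _ _ (by simpa using fun h' => h h'.symm)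

@[simp] theorem Dx_Xx : Dx Xx = 1 := by
  simp [Dx_eq, totalDerivation, Xx, mkDerivation_X]

@[simp] theorem Dx_U (k : ℕ) : Dx (U k) = U (k + 1) := by
  simp [Dx_eq, totalDerivation, U, mkDerivation_X, extend_jet]

@[simp] theorem Dx_V (k : ℕ) : Dx (V k) = V (k + 1) := by
  simp [Dx_eq, totalDerivation, V, mkDerivation_X, extend_jet]

@[simp] theorem Dx_C (a : ℂ) : Dx (C a) = 0 := by
  rw [Dx_eq]; exact derivation_C _ a

@[simp] theorem Dx_ofNat (n : ℕ) [n.AtLeastTwo] : Dx ofNat(n) = 0 := by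
  rw [Dx_eq]; exact Derivation.map_natCast _ n

@[simp] theorem Dx_one : Dx 1 = 0 := by simp [Dx_eq]

@[simp] theorem Dx_zero : Dx 0 = 0 := by simp [Dx_eq]

@[simp] theorem Dx_add (P Q : A2) : Dx (P + Q) = Dx P + Dx Q := by simp [Dx_eq]

@[simp] theorem Dx_sub (P Q : A2) : Dx (P - Q) = Dx P - Dx Q := by simp [Dx_eq]

@[simp] theorem Dx_neg (P : A2) : Dx (-P) = -Dx P := by simp [Dx_eq]

@[simp] theorem Dx_mul (P Q : A2) : Dx (P * Q) = P * Dx Q + Q * Dx P := by simp [Dx_eq]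

theorem Dx_sq (P : A2) : Dx (P ^ 2) = 2 * P * Dx P := by rw [sq, Dx_mul]; ring

@[simp] theorem evolDerivation_Xx (F : A2 × A2) : evolDerivation F Xx = 0 := by
  simp [evolDerivation, Xx, mkDerivation_X]

theorem evolDerivation_U (F : A2 × A2) (k : ℕ) : evolDerivation F (U k) = Dx^[k] F.1 := by
  simp [evolDerivation, U, mkDerivation_X, extend_jet]

theorem evolDerivation_V (F : A2 × A2) (k : ℕ) : evolDerivation F (V k) = Dx^[k] F.2 := by
  simp [evolDerivation, V, mkDerivation_X, extend_jet]

theorem evolDerivation_Dx (F : A2 × A2) (P : A2) :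
    evolDerivation F (Dx P) = Dx (evolDerivation F P) := by
  have h : ⁅evolDerivation F, totalDerivation⁆ = 0 := by
    refine derivation_ext fun i => ?_
    rw [Derivation.commutator_apply, ← Dx_eq, Derivation.zero_apply, sub_eq_zero]
    rcases i with _ | ⟨_ | _, k⟩
    · change evolDerivation F (Dx Xx) = Dx (evolDerivation F Xx)
      simp
    · change evolDerivation F (Dx (U k)) = Dx (evolDerivation F (U k))
      rw [Dx_U, evolDerivation_U, evolDerivation_U, Function.iterate_succ_apply']
    · change evolDerivation F (Dx (V k)) = Dx (evolDerivation F (V k))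
      rw [Dx_V, evolDerivation_V, evolDerivation_V, Function.iterate_succ_apply']
  have := DFunLike.congr_fun h P
  rwa [Derivation.commutator_apply, ← Dx_eq, Derivation.zero_apply, sub_eq_zero] at this

/-- The gauge potential `w = u² + v²`. -/
noncomputable def gaugeW : A2 := U 0 ^ 2 + V 0 ^ 2

/-- The gauge-covariant derivative `∇ = D_x + w`. -/
noncomputable def covD (P : A2) : A2 := Dx P + gaugeW * P

/-- The covariant jet coordinate `∇ᵏ u`. -/
noncomputable def covU : ℕ → A2
  | 0 => U 0
  | k + 1 => covD (covU k)

/-- The covariant jet coordinate `∇ᵏ v`. -/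
noncomputable def covV : ℕ → A2
  | 0 => V 0
  | k + 1 => covD (covV k)

theorem gaugeW_eq : gaugeW = covU 0 ^ 2 + covV 0 ^ 2 := by rw [gaugeW, covU, covV]

theorem Dx_covU (k : ℕ) : Dx (covU k) = covU (k + 1) - gaugeW * covU k := by
  simp [covU, covD]

theorem Dx_covV (k : ℕ) : Dx (covV k) = covV (k + 1) - gaugeW * covV k := by
  simp [covV, covD]

theorem evolDerivation_gaugeW (F : A2 × A2) :
    evolDerivation F gaugeW = 2 * covU 0 * F.1 + 2 * covV 0 * F.2 := by
  simp [gaugeW, covU, covV, evolDerivation_U, evolDerivation_V, Derivation.leibniz_pow]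
  ring

/-- The evolutionary derivation twisted by `s` commutes with `∇` when `∂_t w = D_x s`. -/
theorem evolDerivation_covD {F : A2 × A2} {s : A2} (h : evolDerivation F gaugeW = Dx s) (P : A2) :
    evolDerivation F (covD P) = covD (evolDerivation F P + s * P) - s * covD P := by
  simp only [covD, map_add, evolDerivation_Dx, Derivation.leibniz, smul_eq_mul, h, Dx_add, Dx_mul]
  ring

theorem evolDerivation_covU {F : A2 × A2} {s : A2} (h : evolDerivation F gaugeW = Dx s) (k : ℕ) :
    evolDerivation F (covU k) = covD^[k] (F.1 + s * covU 0) - s * covU k := by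
  induction k with
  | zero => simp [covU, evolDerivation_U]
  | succ k ih =>
    rw [show covU (k + 1) = covD (covU k) from rfl, evolDerivation_covD h, ih,
      Function.iterate_succ_apply', sub_add_cancel]

theorem evolDerivation_covV {F : A2 × A2} {s : A2} (h : evolDerivation F gaugeW = Dx s) (k : ℕ) :
    evolDerivation F (covV k) = covD^[k] (F.2 + s * covV 0) - s * covV k := by
  induction k with
  | zero => simp [covV, evolDerivation_V]
  | succ k ih =>
    rw [show covV (k + 1) = covD (covV k) from rfl, evolDerivation_covD h, ih,
      Function.iterate_succ_apply', sub_add_cancel]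

@[simp] theorem covD_covU (k : ℕ) : covD (covU k) = covU (k + 1) := by rw [covU]

@[simp] theorem covD_covV (k : ℕ) : covD (covV k) = covV (k + 1) := by rw [covV]

theorem covD_iterate_zero (P : A2) : covD^[0] P = P := by rw [Function.iterate_zero, id]

theorem covD_iterate_succ (k : ℕ) (P : A2) : covD^[k + 1] P = covD^[k] (covD P) := by
  rw [Function.iterate_succ_apply]

@[simp] theorem covD_add (P Q : A2) : covD (P + Q) = covD P + covD Q := by simp [covD]; ring

@[simp] theorem covD_sub (P Q : A2) : covD (P - Q) = covD P - covD Q := by simp [covD]; ring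

@[simp] theorem covD_neg (P : A2) : covD (-P) = -covD P := by simp [covD]; ring

@[simp] theorem covD_mul (P Q : A2) : covD (P * Q) = Dx P * Q + P * covD Q := by
  simp [covD]; ring

/-- The flow `u_t = F - s u`, `v_t = G - s v`. -/
noncomputable def gaugeFlow (F G s : A2) : A2 × A2 := (F - s * covU 0, G - s * covV 0)

/-- The compatibility condition saying that `w_t = D_x s` along `gaugeFlow F G s`. -/
def GaugeCompatible (F G s : A2) : Prop :=
  2 * covU 0 * F + 2 * covV 0 * G = Dx s + 2 * gaugeW * s

theorem GaugeCompatible.evolDerivation_gaugeW {F G s : A2} (h : GaugeCompatible F G s) :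
    evolDerivation (gaugeFlow F G s) gaugeW = Dx s := by
  rw [_root_.evolDerivation_gaugeW, gaugeFlow]
  rw [GaugeCompatible, gaugeW_eq] at h
  linear_combination h

theorem GaugeCompatible.evolDerivation_covU {F G s : A2} (h : GaugeCompatible F G s) (k : ℕ) :
    evolDerivation (gaugeFlow F G s) (covU k) = covD^[k] F - s * covU k := by
  rw [_root_.evolDerivation_covU h.evolDerivation_gaugeW, gaugeFlow, sub_add_cancel]

theorem GaugeCompatible.evolDerivation_covV {F G s : A2} (h : GaugeCompatible F G s) (k : ℕ) :
    evolDerivation (gaugeFlow F G s) (covV k) = covD^[k] G - s * covV k := by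
  rw [_root_.evolDerivation_covV h.evolDerivation_gaugeW, gaugeFlow, sub_add_cancel]

theorem pderiv_U_Dx (k : ℕ) (P : A2) :
    pderiv (some (false, k + 1)) (Dx P) =
      pderiv (some (false, k)) P + Dx (pderiv (some (false, k + 1)) P) := by
  have h : ⁅(pderiv (some (false, k + 1)) : Derivation ℂ A2 A2), totalDerivation⁆ =
      (pderiv (some (false, k)) : Derivation ℂ A2 A2) := by
    refine derivation_ext fun i => ?_
    rw [Derivation.commutator_apply, ← Dx_eq]
    rcases i with _ | ⟨_ | _, j⟩
    · change pderiv (some (false, k + 1)) (Dx Xx) - Dx (pderiv (some (false, k + 1)) Xx) = _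
      rw [Dx_Xx]
      simp [Xx, Dx_eq]
    · change pderiv (some (false, k + 1)) (Dx (U j)) - Dx (pderiv (some (false, k + 1)) (U j)) = _
      rw [Dx_U]
      simp only [U, pderiv_X, Pi.single_apply]
      split_ifs <;> simp_all [Dx_eq]
    · change pderiv (some (false, k + 1)) (Dx (V j)) - Dx (pderiv (some (false, k + 1)) (V j)) = _
      rw [Dx_V]
      simp [V]
  have := DFunLike.congr_fun h P
  rw [Derivation.commutator_apply, ← Dx_eq] at this
  rw [← this, sub_add_cancel]

theorem pderiv_U_gaugeW (k : ℕ) : pderiv (some (false, k + 1)) gaugeW = 0 := by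
  simp [gaugeW, U, V, Derivation.leibniz_pow]

theorem pderiv_U_covU_of_lt {j k : ℕ} (h : k < j) : pderiv (some (false, j)) (covU k) = 0 := by
  induction k generalizing j with
  | zero => exact pderiv_X_of_ne (by simp; omega)
  | succ k ih =>
    obtain ⟨j, rfl⟩ := Nat.exists_eq_succ_of_ne_zero (by omega : j ≠ 0)
    simp [covU, covD, pderiv_U_Dx, pderiv_U_gaugeW, ih (show k < j by omega),
      ih (show k < j + 1 by omega)]

theorem pderiv_U_covU_self (k : ℕ) : pderiv (some (false, k)) (covU k) = 1 := by
  induction k with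
  | zero => exact pderiv_X_self _
  | succ k ih =>
    simp [covU, covD, pderiv_U_Dx, pderiv_U_gaugeW, ih, pderiv_U_covU_of_lt (Nat.lt_succ_self k)]

theorem pderiv_U_covV {j k : ℕ} (h : k < j) : pderiv (some (false, j)) (covV k) = 0 := by
  induction k generalizing j with
  | zero => exact pderiv_X_of_ne (by simp)
  | succ k ih =>
    obtain ⟨j, rfl⟩ := Nat.exists_eq_succ_of_ne_zero (by omega : j ≠ 0)
    simp [covV, covD, pderiv_U_Dx, pderiv_U_gaugeW, ih (show k < j by omega),
      ih (show k < j + 1 by omega)]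

/-- The potential of the third-order flow. -/
noncomputable def potential3 (l : ℂ) : A2 :=
  2 * covU 0 * covU 2 - covU 1 ^ 2 + C l * (2 * covV 0 * covV 2 - covV 1 ^ 2)

/-- The system as a gauge transform of the linear system `p_t = p₃`, `q_t = λ q₃`. -/
noncomputable def flow3 (l : ℂ) : A2 × A2 := gaugeFlow (covU 3) (C l * covV 3) (potential3 l)

/-- The potential of the fifth-order flow. -/
noncomputable def potential5 (l : ℂ) : A2 :=
  2 * covU 0 * covU 4 - 2 * covU 1 * covU 3 + covU 2 ^ 2 +
    C l ^ 2 * (2 * covV 0 * covV 4 - 2 * covV 1 * covV 3 + covV 2 ^ 2)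

/-- The fifth-order symmetry, a gauge transform of `p_t = -3 p₅`, `q_t = -3 λ² q₅`. -/
noncomputable def flow5 (l : ℂ) : A2 × A2 :=
  gaugeFlow (-3 * covU 5) (-3 * C l * C l * covV 5) (-3 * potential5 l)

/-- The gauge form of the master symmetry. -/
noncomputable def flowMaster (l : ℂ) : A2 × A2 :=
  gaugeFlow (-(Xx * covU 3) - C (3 / 2) * covU 2) (C l * (-(Xx * covV 3) - C (3 / 2) * covV 2))
    (-(Xx * potential3 l + covU 0 * covU 1 + C l * covV 0 * covV 1))

theorem gaugeCompatible_scaling : GaugeCompatible (Xx * covU 1 + C (1 / 2) * covU 0)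
    (Xx * covV 1 + C (1 / 2) * covV 0) (Xx * gaugeW) := by
  have h : (C (1 / 2) : A2) * 2 = 1 := by rw [← map_ofNat C 2, ← map_mul]; norm_num
  simp only [GaugeCompatible, gaugeW_eq, Dx_mul, Dx_add, Dx_sq, Dx_Xx, Dx_covU, Dx_covV]
  linear_combination (covU 0 ^ 2 + covV 0 ^ 2) * h

theorem gaugeCompatible_projective : GaugeCompatible (Xx ^ 2 * covU 1 + Xx * covU 0)
    (Xx ^ 2 * covV 1 + Xx * covV 0) (Xx ^ 2 * gaugeW) := by
  simp only [GaugeCompatible, gaugeW_eq, Dx_mul, Dx_add, Dx_sq, Dx_Xx, Dx_covU, Dx_covV]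
  ring

theorem gaugeCompatible_flow3 (l : ℂ) :
    GaugeCompatible (covU 3) (C l * covV 3) (potential3 l) := by
  simp only [GaugeCompatible, gaugeW_eq, potential3, Dx_mul, Dx_add, Dx_sub, Dx_sq, Dx_ofNat,
      Dx_C, Dx_covU, Dx_covV]
  ring

theorem gaugeCompatible_flow5 (l : ℂ) :
    GaugeCompatible (-3 * covU 5) (-3 * C l * C l * covV 5) (-3 * potential5 l) := by
  simp only [GaugeCompatible, gaugeW_eq, potential5, Dx_mul, Dx_add, Dx_sub, Dx_neg, Dx_sq,
      Dx_ofNat, Dx_C, Dx_covU, Dx_covV]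
  ring

theorem gaugeCompatible_flowMaster (l : ℂ) :
    GaugeCompatible (-(Xx * covU 3) - C (3 / 2) * covU 2)
      (C l * (-(Xx * covV 3) - C (3 / 2) * covV 2))
      (-(Xx * potential3 l + covU 0 * covU 1 + C l * covV 0 * covV 1)) := by
  have h : (C (3 / 2) : A2) * 2 = 3 := by
    rw [← map_ofNat C 2, ← map_ofNat C 3, ← map_mul]; norm_num
  simp only [GaugeCompatible, gaugeW_eq, potential3, Dx_mul, Dx_add, Dx_sub, Dx_neg, Dx_sq,
      Dx_ofNat, Dx_C, Dx_Xx, Dx_covU, Dx_covV]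
  linear_combination (-covU 0 * covU 2 - C l * covV 0 * covV 2) * h

theorem derivation_ofNat (E : Derivation ℂ A2 A2) (n : ℕ) [n.AtLeastTwo] :
    E (ofNat(n) : A2) = 0 :=
  E.map_natCast n

theorem derivation_sq (E : Derivation ℂ A2 A2) (P : A2) : E (P ^ 2) = 2 * P * E P := by
  rw [sq, E.leibniz, smul_eq_mul]; ring

/-- How an evolutionary derivation along `gaugeFlow F G s` acts on `x` and the covariant jets. -/
structure GaugeAction (E : Derivation ℂ A2 A2) (F G s : A2) : Prop where
  map_Xx : E Xx = 0
  map_covU (k : ℕ) : E (covU k) = covD^[k] F - s * covU k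
  map_covV (k : ℕ) : E (covV k) = covD^[k] G - s * covV k

/-- Brackets of gauge flows are gauge flows, computed from the action on covariant jets. -/
theorem lieBr2_gaugeFlow {F G s F' G' s' F'' G'' s'' : A2} (h : GaugeCompatible F G s)
    (h' : GaugeCompatible F' G' s')
    (H : ∀ E E' : Derivation ℂ A2 A2, GaugeAction E F G s → GaugeAction E' F' G' s' →
      E F' + s * F' - (E' F + s' * F) = F'' ∧ E G' + s * G' - (E' G + s' * G) = G'' ∧
        E s' - E' s = s'') :
    lieBr2 (gaugeFlow F G s) (gaugeFlow F' G' s') = gaugeFlow F'' G'' s'' := by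
  have e : GaugeAction (evolDerivation (gaugeFlow F G s)) F G s :=
    ⟨evolDerivation_Xx _, h.evolDerivation_covU, h.evolDerivation_covV⟩
  have e' : GaugeAction (evolDerivation (gaugeFlow F' G' s')) F' G' s' :=
    ⟨evolDerivation_Xx _, h'.evolDerivation_covU, h'.evolDerivation_covV⟩
  obtain ⟨rfl, rfl, rfl⟩ := H _ _ e e'
  rw [lieBr2_eq]
  generalize evolDerivation (gaugeFlow F G s) = E at *
  generalize evolDerivation (gaugeFlow F' G' s') = E' at *
  ext1 <;> simp only [gaugeFlow, map_sub, Derivation.leibniz, smul_eq_mul, e.map_covU, e.map_covV,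
    e'.map_covU, e'.map_covV, covD_iterate_zero] <;> ring

theorem lieBr2_scaling_flow3 (l : ℂ) :
    lieBr2 (gaugeFlow (Xx * covU 1 + C (1 / 2) * covU 0) (Xx * covV 1 + C (1 / 2) * covV 0)
      (Xx * gaugeW)) (flow3 l) = (3 * (flow3 l).1, 3 * (flow3 l).2) := by
  have hF : gaugeFlow (3 * covU 3) (3 * (C l * covV 3)) (3 * potential3 l) =
      (3 * (flow3 l).1, 3 * (flow3 l).2) := by
    ext1 <;> simp only [flow3, gaugeFlow] <;> ring
  have hc : (C (1 / 2) : A2) * 2 = 1 := by rw [← map_ofNat C 2, ← map_mul]; norm_num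
  rw [← hF, flow3]
  refine lieBr2_gaugeFlow gaugeCompatible_scaling (gaugeCompatible_flow3 l) ?_
  rintro E E' ⟨hx, hu, hv⟩ ⟨hx', hu', hv'⟩
  refine ⟨?_, ?_, ?_⟩
  · simp only [map_add, Derivation.leibniz, derivation_C, smul_eq_mul, hx', hu, hu',
      covD_iterate_succ, covD_iterate_zero, covD_covU, covD_add, covD_mul, Dx_Xx, Dx_C, Dx_one,
      Dx_zero]
    ring
  · simp only [map_add, Derivation.leibniz, derivation_C, smul_eq_mul, hx', hv, hv',
      covD_iterate_succ, covD_iterate_zero, covD_covV, covD_add, covD_mul, Dx_Xx, Dx_C, Dx_one,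
      Dx_zero]
    ring
  · simp only [potential3, gaugeW_eq, map_add, map_sub, Derivation.leibniz, derivation_sq,
      derivation_C, derivation_ofNat, smul_eq_mul, hx', hu, hv, hu', hv', covD_iterate_succ,
      covD_iterate_zero, covD_covU, covD_covV, covD_add, covD_mul, Dx_Xx, Dx_C, Dx_one, Dx_zero]
    linear_combination (2 * covU 0 * covU 2 - covU 1 ^ 2 +
      C l * (2 * covV 0 * covV 2 - covV 1 ^ 2)) * hc

theorem lieBr2_projective_flow3 (l : ℂ) :
    lieBr2 (gaugeFlow (Xx ^ 2 * covU 1 + Xx * covU 0) (Xx ^ 2 * covV 1 + Xx * covV 0)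
      (Xx ^ 2 * gaugeW)) (flow3 l) =
      (-6 : ℂ) • flowMaster l := by
  have hc : (C (3 / 2) : A2) * 2 = 3 := by
    rw [← map_ofNat C 2, ← map_ofNat C 3, ← map_mul]; norm_num
  have hF : gaugeFlow (6 * Xx * covU 3 + 9 * covU 2) (C l * (6 * Xx * covV 3 + 9 * covV 2))
      (6 * (Xx * potential3 l + covU 0 * covU 1 + C l * covV 0 * covV 1)) =
      (-6 : ℂ) • flowMaster l := by
    ext1 <;> simp only [flowMaster, gaugeFlow, Prod.smul_mk, smul_eq_C_mul, map_neg, map_ofNat]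
    · linear_combination (-3 * covU 2) * hc
    · linear_combination (-3 * C l * covV 2) * hc
  rw [← hF, flow3]
  refine lieBr2_gaugeFlow gaugeCompatible_projective (gaugeCompatible_flow3 l) ?_
  rintro E E' ⟨hx, hu, hv⟩ ⟨hx', hu', hv'⟩
  refine ⟨?_, ?_, ?_⟩
  · simp only [map_add, Derivation.leibniz, derivation_sq, smul_eq_mul, hx', hu, hu',
      covD_iterate_succ, covD_iterate_zero, covD_covU, covD_add, covD_mul, Dx_mul, Dx_add, Dx_sq,
      Dx_Xx, Dx_ofNat, Dx_one, Dx_zero]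
    ring
  · simp only [map_add, Derivation.leibniz, derivation_sq, derivation_C, smul_eq_mul, hx', hv,
      hv', covD_iterate_succ, covD_iterate_zero, covD_covV, covD_add, covD_mul, Dx_mul, Dx_add,
      Dx_sq, Dx_Xx, Dx_C, Dx_ofNat, Dx_one, Dx_zero]
    ring
  · simp only [potential3, gaugeW_eq, map_add, map_sub, Derivation.leibniz, derivation_sq,
      derivation_C, derivation_ofNat, smul_eq_mul, hx', hu, hv, hu', hv', covD_iterate_succ,
      covD_iterate_zero, covD_covU, covD_covV, covD_add, covD_mul, Dx_mul, Dx_sq, Dx_Xx, Dx_ofNat,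
      Dx_one]
    ring

theorem lieBr2_flowMaster_flow3 (l : ℂ) : lieBr2 (flowMaster l) (flow3 l) = flow5 l := by
  have hc : (C (3 / 2) : A2) * 2 = 3 := by
    rw [← map_ofNat C 2, ← map_ofNat C 3, ← map_mul]; norm_num
  rw [flowMaster, flow3, flow5]
  refine lieBr2_gaugeFlow (gaugeCompatible_flowMaster l) (gaugeCompatible_flow3 l) ?_
  rintro E E' ⟨hx, hu, hv⟩ ⟨hx', hu', hv'⟩
  refine ⟨?_, ?_, ?_⟩
  · simp only [map_sub, map_neg, Derivation.leibniz, derivation_C, smul_eq_mul, hx', hu, hu',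
      covD_iterate_succ, covD_iterate_zero, covD_covU, covD_add, covD_sub, covD_neg, covD_mul,
      Dx_Xx, Dx_C, Dx_one, Dx_zero]
    ring
  · simp only [map_sub, map_neg, Derivation.leibniz, derivation_C, smul_eq_mul, hx', hv, hv',
      covD_iterate_succ, covD_iterate_zero, covD_covV, covD_add, covD_sub, covD_neg, covD_mul,
      Dx_Xx, Dx_C, Dx_one, Dx_zero]
    ring
  · simp only [potential3, potential5, map_add, map_sub, map_neg, Derivation.leibniz,
      derivation_sq, derivation_C, derivation_ofNat, smul_eq_mul, hx', hu, hv, hu', hv',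
      covD_iterate_succ, covD_iterate_zero, covD_covU, covD_covV, covD_add, covD_sub, covD_neg,
      covD_mul, Dx_Xx, Dx_C, Dx_one, Dx_zero]
    linear_combination (-covU 0 * covU 4 + covU 1 * covU 3 - covU 2 ^ 2 +
      C l ^ 2 * (-covV 0 * covV 4 + covV 1 * covV 3 - covV 2 ^ 2)) * hc

theorem lieBr2_flow5_flow3 (l : ℂ) : lieBr2 (flow5 l) (flow3 l) = 0 := by
  have hF : gaugeFlow 0 0 0 = 0 := by simp [gaugeFlow]
  rw [← hF, flow5, flow3]
  refine lieBr2_gaugeFlow (gaugeCompatible_flow5 l) (gaugeCompatible_flow3 l) ?_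
  rintro E E' ⟨hx, hu, hv⟩ ⟨hx', hu', hv'⟩
  refine ⟨?_, ?_, ?_⟩
  · simp only [map_neg, Derivation.leibniz, derivation_ofNat, smul_eq_mul, hu, hu',
      covD_iterate_succ, covD_iterate_zero, covD_covU, covD_add, covD_mul, Dx_neg, Dx_ofNat,
      Dx_zero]
    ring
  · simp only [map_neg, Derivation.leibniz, derivation_C, derivation_ofNat, smul_eq_mul, hv, hv',
      covD_iterate_succ, covD_iterate_zero, covD_covV, covD_add, covD_mul, Dx_mul, Dx_add, Dx_neg,
      Dx_C, Dx_ofNat, Dx_zero]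
    ring
  · simp only [potential3, potential5, map_add, map_sub, map_neg, Derivation.leibniz,
      derivation_sq, derivation_C, derivation_ofNat, smul_eq_mul, hu, hv, hu', hv',
      covD_iterate_succ, covD_iterate_zero, covD_covU, covD_covV, covD_add, covD_mul, Dx_mul,
      Dx_add, Dx_neg, Dx_C, Dx_ofNat, Dx_zero]
    ring

theorem flow5_ne_zero (l : ℂ) : flow5 l ≠ 0 := by
  intro h
  have h1 : pderiv (some (false, 5)) (flow5 l).1 = 0 := by simp [h]
  simp [flow5, gaugeFlow, potential5, derivation_ofNat, Derivation.leibniz_pow, pderiv_U_covU_self,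
    pderiv_U_covU_of_lt, pderiv_U_covV] at h1

/-- The system from Example 6 (Wang et al.) is (1/2,1/2)-homogeneous of weight 3,
and `τ = −(1/6)[(x²u₁ + xu, x²v₁ + xv), K]` is a master symmetry:
`[τ,K] ≠ 0` and `[[τ,K],K] = 0`. -/
theorem systemNew14_homogeneous_and_master_symmetry (l : ℂ) (hl0 : l ≠ 0) (hl1 : l ≠ 1) :
    let K : A2 × A2 :=
      (U 3 + 3 * Dx ((U 0 ^ 2 + V 0 ^ 2) * U 1) - 2 * C (l - 1) * U 0 * V 0 * V 2 +
         C (l + 2) * U 0 * V 1 ^ 2 + 3 * (U 0 ^ 4 + V 0 ^ 4) * U 1 +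
         3 * U 0 * U 1 ^ 2 - 2 * C (l - 1) * (U 0 ^ 2 + 3 * V 0 ^ 2) * U 0 * V 0 * V 1 -
         2 * C (2 * l - 5) * U 0 ^ 2 * V 0 ^ 2 * U 1 -
         C (l - 1) * U 0 * V 0 ^ 2 * (U 0 ^ 2 + V 0 ^ 2) ^ 2,
       C l * V 3 + 2 * C (l - 1) * U 0 * V 0 * U 2 + 6 * C l * U 0 * U 1 * V 1 +
         9 * C l * V 0 * V 1 ^ 2 + 3 * C l * (U 0 ^ 2 + V 0 ^ 2) * V 2 +
         C (2 * l + 1) * V 0 * U 1 ^ 2 +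
         2 * C (l - 1) * U 0 * V 0 * (V 0 ^ 2 + 3 * U 0 ^ 2) * U 1 +
         3 * C l * (U 0 ^ 4 + V 0 ^ 4) * V 1 +
         2 * C (5 * l - 2) * U 0 ^ 2 * V 0 ^ 2 * V 1 +
         C (l - 1) * U 0 ^ 2 * V 0 * (U 0 ^ 2 + V 0 ^ 2) ^ 2)
    let τ : A2 × A2 := -((1 / 6 : ℂ) •
      lieBr2 (Xx ^ 2 * U 1 + Xx * U 0, Xx ^ 2 * V 1 + Xx * V 0) K)
    lieBr2 (Xx * U 1 + C (1 / 2) * U 0, Xx * V 1 + C (1 / 2) * V 0) K =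
      (3 * K.1, 3 * K.2) ∧
    lieBr2 τ K ≠ 0 ∧ lieBr2 (lieBr2 τ K) K = 0 := by
  intro K τ
  have hK : K = flow3 l := by
    ext1 <;> simp only [K, flow3, gaugeFlow, potential3, covU, covV, covD, gaugeW, Dx_mul, Dx_add,
      Dx_sq, Dx_ofNat, Dx_U, Dx_V, map_add, map_sub, map_mul, map_ofNat, map_one] <;> ring
  have hτ : τ = flowMaster l := by
    have hX : (Xx ^ 2 * U 1 + Xx * U 0, Xx ^ 2 * V 1 + Xx * V 0) =
        gaugeFlow (Xx ^ 2 * covU 1 + Xx * covU 0) (Xx ^ 2 * covV 1 + Xx * covV 0)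
          (Xx ^ 2 * gaugeW) := by
      ext1 <;> simp only [gaugeFlow, covU, covV, covD, Dx_U, Dx_V] <;> ring
    simp only [τ]
    rw [hK, hX, lieBr2_projective_flow3, smul_smul, ← neg_smul]
    norm_num
  have hS : (Xx * U 1 + C (1 / 2) * U 0, Xx * V 1 + C (1 / 2) * V 0) =
      gaugeFlow (Xx * covU 1 + C (1 / 2) * covU 0) (Xx * covV 1 + C (1 / 2) * covV 0)
        (Xx * gaugeW) := by
    ext1 <;> simp only [gaugeFlow, covU, covV, covD, Dx_U, Dx_V] <;> ring
  rw [hτ, hK, hS, lieBr2_flowMaster_flow3]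
  exact ⟨lieBr2_scaling_flow3 l, flow5_ne_zero l, lieBr2_flow5_flow3 l⟩
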